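/- Let m ≥ 1, and let x and L be natural numbers with x < m·2^(L+1). Define y as the result of the following greedy process: start with y = 0 and, for ℓ = L, L−1, …, 0 in decreasing order, replace y by y + m·2^ℓ whenever y + m·2^ℓ ≤ x. Then the final value satisfies y = m·⌊x/m⌋; in particular the final y equals x if and only if m divides x. -/

import Mathlib

/-- The greedy balance-scale process of the m-Congruence protocol:
starting from `0`, for `ℓ = L, L-1, …, 0` add the weight `m * 2^ℓ`
whenever doing so does not exceed `x`. -/
def greedyCongruence (m x L : ℕ) : ℕ :=
  (List.range (L + 1)).reverse.foldl
    (fun y ℓ => if y + m * 2 ^ ℓ ≤ x then y + m * 2 ^ ℓ else y) 0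

theorem greedy_aux (m x : ℕ) (hm : 1 ≤ m) (n : ℕ) : ∀ y : ℕ, m ∣ y → y ≤ x → x < y + m * 2 ^ n →
    (List.range n).reverse.foldl
      (fun y ℓ => if y + m * 2 ^ ℓ ≤ x then y + m * 2 ^ ℓ else y) y = m * (x / m) := by
  induction n with
  | zero =>
    intro y hy hle hlt
    obtain ⟨k, rfl⟩ := hy
    have h : x / m = k := by
      apply Nat.div_eq_of_lt_le
      · rw [Nat.mul_comm]; exact hle
      · rw [Nat.succ_mul, Nat.mul_comm k m]; simpa using hlt
    simp [h]
  | succ n ih =>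
    intro y hy hle hlt
    rw [List.range_succ, List.reverse_append]
    simp only [List.reverse_singleton, List.singleton_append, List.foldl_cons]
    have h2 : m * 2 ^ (n + 1) = m * 2 ^ n + m * 2 ^ n := by ring
    split_ifs with h
    · exact ih _ (dvd_add hy (Dvd.intro _ rfl)) h (by omega)
    · exact ih _ hy hle (by omega)

theorem stmt2 (m x L : ℕ) (hm : 1 ≤ m) (hx : x < m * 2 ^ (L + 1)) :
    greedyCongruence m x L = m * (x / m) ∧
      (greedyCongruence m x L = x ↔ m ∣ x) := by
  have h : greedyCongruence m x L = m * (x / m) :=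
    greedy_aux m x hm (L + 1) 0 (dvd_zero m) (Nat.zero_le x) (by simpa using hx)
  refine ⟨h, ?_⟩
  rw [h]
  exact ⟨fun e => ⟨_, e.symm⟩, fun d => Nat.mul_div_cancel' d⟩
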